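/- Let p_0 ∈ (1/2,1), M ≥ 1, p ∈ (0,1)^M, and let N > M and p′ = (p_1,…,p_M, p_0,…,p_0) ∈ (0,1)^N. Let (Z^∞_n)_{n≥0} be the backwards branching-like process associated to (M, p, p_0) and let (Z^N_n)_{n≥0} be the backwards branching-like process associated to the standard excited random walk with cookie vector p′ (i.e., to (N, p′, 1/2)). If (Z^N_n) is positive recurrent with stationary distribution π_N, then (Z^∞_n) is positive recurrent with stationary distribution π_∞, and ∑_{k≥0} k π_∞(k) ≤ ∑_{k≥0} k π_N(k). -/

import Mathlib

open MeasureTheory ProbabilityTheory Filter Topology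
open scoped ENNReal NNReal

/-- The success probability of the `j+1`-st trial: `p (j+1)` for `j < M`, and `p₀`
afterwards. -/
noncomputable def cookieSeq (M : ℕ) (p : Fin M → ℝ) (p₀ : ℝ) (j : ℕ) : ℝ :=
  if h : j < M then p ⟨j, h⟩ else p₀

/-- `bbTrans q l m` is the transition probability `p(l,m) = P(A (l+1) = m)` of the
backwards branching-like process: the probability that in a sequence of independent
Bernoulli trials whose `j`-th trial succeeds with probability `q j` (`j` 0-indexed),
there are exactly `m` failures before the `(l+1)`-st success.  Equivalently, among the
first `m + l` trials there are exactly `l` successes and trial `m + l` is a success. -/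
noncomputable def bbTrans (q : ℕ → ℝ) (l m : ℕ) : ℝ :=
  (∑ s ∈ Finset.univ.filter
      (fun s : Fin (m + l) → Bool =>
        (Finset.univ.filter fun j => s j = true).card = l),
    ∏ j : Fin (m + l), (if s j then q (j : ℕ) else 1 - q (j : ℕ)))
    * q (m + l)

/-- `IsStationaryDist q π` : `π` is a stationary distribution of the backwards
branching-like process with transition probabilities `bbTrans q`: a probability mass
function on `ℕ` with `π m = ∑' l, π l * p(l,m)` for all `m`. -/
def IsStationaryDist (q : ℕ → ℝ) (π : ℕ → ℝ) : Prop :=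
  (∀ k, 0 ≤ π k) ∧ (∑' k, π k) = 1 ∧ ∀ m, π m = ∑' l, π l * bbTrans q l m

/-- `returnProb q n` is the probability that the backwards branching-like process with
transition probabilities `bbTrans q`, started at `0`, first returns to `0` at time `n`
(i.e. `P₀ (T₀⁺ = n)`): the sum over all paths `0, z 1, …, z (n-1), 0` with the interior
states nonzero of the product of the transition probabilities along the path. -/
noncomputable def returnProb (q : ℕ → ℝ) (n : ℕ) : ℝ :=
  if hn : n = 0 then 0
  else
    ∑' z : Fin (n - 1) → {k : ℕ // 0 < k},
      ∏ i ∈ Finset.range n,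
        bbTrans q
          (if h : 1 ≤ i ∧ i ≤ n - 1 then (z ⟨i - 1, by omega⟩ : ℕ) else 0)
          (if h : 1 ≤ i + 1 ∧ i + 1 ≤ n - 1 then (z ⟨i, by omega⟩ : ℕ) else 0)

/-- The upper tail `m ↦ ∑_{k ≥ m} μ k` of a weight function on `ℕ`. -/
noncomputable def tail (μ : ℕ → ℝ≥0∞) (m : ℕ) : ℝ≥0∞ :=
  ∑' k, if m ≤ k then μ k else 0

lemma tail_eq_tsum_add (μ : ℕ → ℝ≥0∞) (m : ℕ) : tail μ m = ∑' k, μ (m + k) := by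
  have h := (add_right_injective m).tsum_eq (f := fun k => if m ≤ k then μ k else 0) (by
    intro k hk
    have : m ≤ k := by
      by_contra hmk
      simp [hmk] at hk
    exact ⟨k - m, by simp; omega⟩)
  rw [tail, ← h]
  simp

lemma tail_zero (μ : ℕ → ℝ≥0∞) : tail μ 0 = ∑' k, μ k := by
  simp [tail]

lemma tail_le_tsum (μ : ℕ → ℝ≥0∞) (m : ℕ) : tail μ m ≤ ∑' k, μ k :=
  ENNReal.tsum_le_tsum fun k => by split_ifs <;> simp

lemma tail_eq_add_tail_succ (μ : ℕ → ℝ≥0∞) (m : ℕ) : tail μ m = μ m + tail μ (m + 1) := by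
  rw [tail_eq_tsum_add, tail_eq_tsum_add, tsum_eq_zero_add' ENNReal.summable]
  simp [add_assoc, add_comm 1]

lemma sum_range_add_tail (μ : ℕ → ℝ≥0∞) (n : ℕ) :
    ∑ k ∈ Finset.range n, μ k + tail μ n = ∑' k, μ k := by
  rw [tail_eq_tsum_add]
  simp_rw [add_comm n]
  exact ENNReal.summable.sum_add_tsum_nat_add'

lemma tendsto_tail_atTop (μ : ℕ → ℝ≥0∞) (hμ : ∑' k, μ k ≠ ∞) :
    Tendsto (tail μ) atTop (𝓝 0) := by
  have h := ENNReal.tendsto_sum_nat_add μ hμ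
  refine h.congr fun n => ?_
  rw [tail_eq_tsum_add]
  simp_rw [add_comm n]

lemma eq_of_tail_eq {μ ν : ℕ → ℝ≥0∞} (hμ : ∑' k, μ k ≠ ∞) (h : ∀ m, tail μ m = tail ν m) :
    μ = ν := by
  funext m
  have h1 := tail_eq_add_tail_succ μ m
  have h2 := tail_eq_add_tail_succ ν m
  rw [h m, h (m + 1), h2] at h1
  have hfin : tail ν (m + 1) ≠ ∞ := by
    rw [← h]
    exact ne_top_of_le_ne_top hμ (tail_le_tsum μ _)
  exact ((ENNReal.add_left_inj hfin).1 h1).symm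

lemma tail_sub_succ {t : ℕ → ℝ≥0∞} (hanti : Antitone t)
    (hlim : Tendsto t atTop (𝓝 0)) (m : ℕ) : tail (fun k => t k - t (k + 1)) m = t m := by
  have hpart : ∀ n, ∑ k ∈ Finset.range n, (t (m + k) - t (m + k + 1)) + t (m + n) = t m := by
    intro n
    induction n with
    | zero => simp
    | succ n ih =>
      rw [Finset.sum_range_succ, add_assoc, ← add_assoc m n 1,
        tsub_add_cancel_of_le (hanti (Nat.le_succ _)), ih]
  rw [tail_eq_tsum_add]
  have h1 := ENNReal.tendsto_nat_tsum fun k => t (m + k) - t (m + k + 1)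
  have h2 : Tendsto (fun n => t (m + n)) atTop (𝓝 0) :=
    hlim.comp (tendsto_atTop_mono (fun n => Nat.le_add_left n m) tendsto_id)
  have h3 := h1.add h2
  simp_rw [hpart, add_zero] at h3
  exact (tendsto_nhds_unique tendsto_const_nhds h3).symm

/-- Summation by parts against a monotone function. -/
lemma tsum_mul_eq_tail (μ : ℕ → ℝ≥0∞) {F : ℕ → ℝ≥0∞} (hF : Monotone F) :
    ∑' x, μ x * F x
      = (∑' x, μ x) * F 0 + ∑' l, tail μ (l + 1) * (F (l + 1) - F l) := by
  have hF' : ∀ x, F x = F 0 + ∑' l, if l + 1 ≤ x then F (l + 1) - F l else 0 := by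
    intro x
    rw [tsum_eq_sum (s := Finset.range x) (by
      intro l hl
      rw [if_neg]
      simpa using hl)]
    rw [Finset.sum_congr rfl (g := fun l => F (l + 1) - F l) (by
      intro l hl
      rw [if_pos]
      simpa using hl)]
    induction x with
    | zero => simp
    | succ x ih =>
      rw [Finset.sum_range_succ, ← add_assoc, ← ih, add_tsub_cancel_of_le (hF (Nat.le_succ x))]
  calc ∑' x, μ x * F x
      = ∑' x, (μ x * F 0 + ∑' l, μ x * if l + 1 ≤ x then F (l + 1) - F l else 0) := by
        refine tsum_congr fun x => ?_
        rw [ENNReal.tsum_mul_left, ← mul_add, ← hF' x]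
    _ = _ := by
        rw [ENNReal.tsum_add, ENNReal.tsum_mul_right, ENNReal.tsum_comm]
        congr 1
        refine tsum_congr fun l => ?_
        rw [tail, ← ENNReal.tsum_mul_right]
        refine tsum_congr fun x => ?_
        split_ifs <;> simp

lemma tsum_mul_le_of_tail_le {μ ν : ℕ → ℝ≥0∞} (h : ∀ m, tail μ m ≤ tail ν m)
    {F : ℕ → ℝ≥0∞} (hF : Monotone F) : ∑' x, μ x * F x ≤ ∑' x, ν x * F x := by
  rw [tsum_mul_eq_tail μ hF, tsum_mul_eq_tail ν hF, ← tail_zero, ← tail_zero]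
  refine add_le_add (mul_le_mul_left (h 0) _) (ENNReal.tsum_le_tsum fun l => ?_)
  exact mul_le_mul_left (h (l + 1)) _

lemma tail_kernel (μ : ℕ → ℝ≥0∞) (K : ℕ → ℕ → ℝ≥0∞) (m : ℕ) :
    tail (fun k => ∑' l, μ l * K l k) m = ∑' l, μ l * tail (K l) m := by
  unfold tail
  simp_rw [← ENNReal.tsum_mul_left]
  rw [ENNReal.tsum_comm]
  refine tsum_congr fun k => ?_
  split_ifs <;> simp

/-- The law at time `n` of the chain with kernel `K` started at `0`. -/
noncomputable def lawFromZero (K : ℕ → ℕ → ℝ≥0∞) : ℕ → ℕ → ℝ≥0∞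
  | 0 => Pi.single 0 1
  | n + 1 => fun m => ∑' l, lawFromZero K n l * K l m

lemma tsum_lawFromZero {K : ℕ → ℕ → ℝ≥0∞} (hK : ∀ l, ∑' m, K l m = 1) (n : ℕ) :
    ∑' m, lawFromZero K n m = 1 := by
  induction n with
  | zero => simp [lawFromZero, tsum_pi_single]
  | succ n ih =>
    simp_rw [lawFromZero]
    rw [ENNReal.tsum_comm]
    simp_rw [ENNReal.tsum_mul_left, hK, mul_one, ih]

lemma tail_lawFromZero_zero_le (K : ℕ → ℕ → ℝ≥0∞) {ν : ℕ → ℝ≥0∞} (hν : ∑' m, ν m = 1) (m : ℕ) :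
    tail (lawFromZero K 0) m ≤ tail ν m := by
  rcases Nat.eq_zero_or_pos m with rfl | hm
  · rw [tail_zero, tail_zero, hν]
    simp [lawFromZero, tsum_pi_single]
  · have : tail (lawFromZero K 0) m = 0 := by
      refine ENNReal.tsum_eq_zero.2 fun k => ?_
      split_ifs with h
      · have : k ≠ 0 := by omega
        simp [lawFromZero, this]
      · rfl
    simp [this]

/-- A stochastically monotone kernel dominated by a kernel with a stationary distribution `ν`
has a stationary distribution dominated by `ν`. -/
lemma exists_stationary_tail_le {K K' : ℕ → ℕ → ℝ≥0∞} (hK' : ∀ l, ∑' m, K' l m = 1)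
    (hmono : ∀ m, Monotone fun l => tail (K' l) m)
    (hle : ∀ l m, tail (K' l) m ≤ tail (K l) m)
    {ν : ℕ → ℝ≥0∞} (hν : ∑' m, ν m = 1) (hstat : ∀ m, ν m = ∑' l, ν l * K l m) :
    ∃ μ : ℕ → ℝ≥0∞, ∑' m, μ m = 1 ∧ (∀ m, μ m = ∑' l, μ l * K' l m)
      ∧ ∀ m, tail μ m ≤ tail ν m := by
  set t : ℕ → ℕ → ℝ≥0∞ := fun n => tail (lawFromZero K' n) with ht
  have hstep : ∀ n m, t (n + 1) m = ∑' l, lawFromZero K' n l * tail (K' l) m :=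
    fun n m => tail_kernel _ _ m
  have htmono : ∀ n m, t n m ≤ t (n + 1) m := by
    intro n
    induction n with
    | zero => exact tail_lawFromZero_zero_le K' (tsum_lawFromZero hK' _)
    | succ n ih =>
      intro m
      rw [hstep, hstep]
      exact tsum_mul_le_of_tail_le ih (hmono m)
  have htν : ∀ n m, t n m ≤ tail ν m := by
    intro n
    induction n with
    | zero => exact tail_lawFromZero_zero_le K' hν
    | succ n ih =>
      intro m
      calc t (n + 1) m ≤ ∑' l, ν l * tail (K' l) m := by
            rw [hstep]
            exact tsum_mul_le_of_tail_le ih (hmono m)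
        _ ≤ ∑' l, ν l * tail (K l) m := by
            gcongr
            exact hle _ _
        _ = tail ν m := by
            rw [← tail_kernel]
            congr 1
            funext k
            exact (hstat k).symm
  set s : ℕ → ℝ≥0∞ := fun m => ⨆ n, t n m with hs
  have hsν : ∀ m, s m ≤ tail ν m := fun m => iSup_le fun n => htν n m
  have hsanti : Antitone s := by
    refine antitone_nat_of_succ_le fun m => iSup_mono fun n => ?_
    rw [ht]
    simp only
    rw [tail_eq_add_tail_succ _ m]
    exact le_add_self
  have hν_fin : ∑' m, ν m ≠ ∞ := by simp [hν]
  have hslim : Tendsto s atTop (𝓝 0) :=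
    tendsto_of_tendsto_of_tendsto_of_le_of_le tendsto_const_nhds (tendsto_tail_atTop ν hν_fin)
      (fun _ => zero_le) hsν
  set μ : ℕ → ℝ≥0∞ := fun k => s k - s (k + 1) with hμ
  have htail : ∀ m, tail μ m = s m := tail_sub_succ hsanti hslim
  have hs0 : s 0 = 1 := by
    simp [hs, ht, tail_zero, tsum_lawFromZero hK']
  have hμ1 : ∑' m, μ m = 1 := by rw [← tail_zero, htail, hs0]
  refine ⟨μ, hμ1, ?_, fun m => (htail m).trans_le (hsν m)⟩
  refine fun m => congrFun (eq_of_tail_eq (ν := fun m => ∑' l, μ l * K' l m)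
    (by simp [hμ1]) fun m => ?_) m
  have hsup : ∑' l, s (l + 1) * (tail (K' (l + 1)) m - tail (K' l) m)
      = ⨆ n, ∑' l, t n (l + 1) * (tail (K' (l + 1)) m - tail (K' l) m) := by
    simp_rw [hs, ENNReal.iSup_mul]
    simp_rw [← lintegral_count]
    refine lintegral_iSup (fun n => measurable_from_top) ?_
    refine monotone_nat_of_le_succ fun n l => ?_
    simp only
    gcongr
    exact htmono n _
  rw [tail_kernel, tsum_mul_eq_tail μ (hmono m), hμ1, htail]
  simp_rw [htail]
  rw [hsup, ENNReal.add_iSup]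
  have : s m = ⨆ n, t (n + 1) m :=
    ((monotone_nat_of_le_succ fun n => htmono n m).iSup_nat_add 1).symm
  rw [this]
  refine iSup_congr fun n => ?_
  rw [hstep, tsum_mul_eq_tail _ (hmono m), tsum_lawFromZero hK']

/-- The probability that the chain with kernel `K` started at `x` is nonzero at times
`1, …, n`. -/
noncomputable def avoidProb (K : ℕ → ℕ → ℝ≥0∞) : ℕ → ℕ → ℝ≥0∞
  | 0 => fun _ => 1
  | n + 1 => fun x => ∑' y, K x y * if y = 0 then 0 else avoidProb K n y

/-- The probability that the chain with kernel `K` started at `x` hits `0` for the first time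
(after time `0`) at time `n + 1`. -/
noncomputable def hitProb (K : ℕ → ℕ → ℝ≥0∞) : ℕ → ℕ → ℝ≥0∞
  | 0 => fun x => K x 0
  | n + 1 => fun x => ∑' y, K x y * if y = 0 then 0 else hitProb K n y

lemma avoidProb_eq_add {K : ℕ → ℕ → ℝ≥0∞} (hK : ∀ l, ∑' m, K l m = 1) (n x : ℕ) :
    avoidProb K n x = hitProb K n x + avoidProb K (n + 1) x := by
  induction n generalizing x with
  | zero =>
    have h : ∀ y, K x y = (if y = 0 then K x 0 else 0) + K x y * (if y = 0 then 0 else 1) := by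
      intro y
      split_ifs with h <;> simp [h]
    simp only [avoidProb, hitProb]
    rw [← tsum_ite_eq (0 : ℕ) fun _ => K x 0, ← ENNReal.tsum_add, ← tsum_congr h, hK x]
  | succ n ih =>
    rw [avoidProb, hitProb, avoidProb, ← ENNReal.tsum_add]
    refine tsum_congr fun y => ?_
    rw [← mul_add]
    split_ifs
    · simp
    · rw [ih]

lemma monotone_ite_zero {f : ℕ → ℝ≥0∞} (hf : Monotone f) :
    Monotone fun y => if y = 0 then 0 else f y := by
  intro a b hab
  by_cases ha : a = 0
  · simp [ha]
  · have hb : b ≠ 0 := by omega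
    simpa [ha, hb] using hf hab

lemma monotone_avoidProb {K : ℕ → ℕ → ℝ≥0∞} (hmono : ∀ m, Monotone fun l => tail (K l) m)
    (n : ℕ) : Monotone (avoidProb K n) := by
  induction n with
  | zero => exact monotone_const
  | succ n ih =>
    intro a b hab
    exact tsum_mul_le_of_tail_le (fun m => hmono m hab) (monotone_ite_zero ih)

lemma avoidProb_le {K K' : ℕ → ℕ → ℝ≥0∞} (hmono : ∀ m, Monotone fun l => tail (K' l) m)
    (hle : ∀ l m, tail (K' l) m ≤ tail (K l) m) (n x : ℕ) :
    avoidProb K' n x ≤ avoidProb K n x := by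
  induction n generalizing x with
  | zero => exact le_rfl
  | succ n ih =>
    refine (tsum_mul_le_of_tail_le (hle x) (monotone_ite_zero (monotone_avoidProb hmono n))).trans ?_
    refine ENNReal.tsum_le_tsum fun y => ?_
    gcongr
    split_ifs
    · exact le_rfl
    · exact ih y

lemma sum_hitProb_add_avoidProb {K : ℕ → ℕ → ℝ≥0∞} (hK : ∀ l, ∑' m, K l m = 1) (n x : ℕ) :
    ∑ k ∈ Finset.range n, hitProb K k x + avoidProb K n x = 1 := by
  induction n with
  | zero => simp [avoidProb]
  | succ n ih => rw [Finset.sum_range_succ, add_assoc, ← avoidProb_eq_add hK, ih]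

lemma avoidProb_eq_tail {K : ℕ → ℕ → ℝ≥0∞} (hK : ∀ l, ∑' m, K l m = 1) {x : ℕ}
    (hx : ∑' n, hitProb K n x = 1) (n : ℕ) :
    avoidProb K n x = tail (fun k => hitProb K k x) n := by
  have h1 := sum_hitProb_add_avoidProb hK n x
  have h2 := sum_range_add_tail (fun k => hitProb K k x) n
  rw [hx, ← h1] at h2
  refine ((ENNReal.add_right_inj ?_).1 h2).symm
  exact ne_top_of_le_ne_top ENNReal.one_ne_top (h1 ▸ le_self_add)

lemma tsum_tail (μ : ℕ → ℝ≥0∞) : ∑' m, tail μ m = ∑' n, ((n + 1 : ℕ) : ℝ≥0∞) * μ n := by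
  unfold tail
  rw [ENNReal.tsum_comm]
  refine tsum_congr fun n => ?_
  rw [tsum_eq_sum (s := Finset.range (n + 1)) (by
    intro k hk
    rw [if_neg]
    simpa [Nat.lt_succ_iff] using hk)]
  rw [Finset.sum_congr rfl (g := fun _ => μ n) (by
    intro k hk
    rw [if_pos]
    simpa [Nat.lt_succ_iff] using hk)]
  simp

lemma hitProb_comparison {K K' : ℕ → ℕ → ℝ≥0∞} (hK : ∀ l, ∑' m, K l m = 1)
    (hK' : ∀ l, ∑' m, K' l m = 1)
    (hmono : ∀ m, Monotone fun l => tail (K' l) m)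
    (hle : ∀ l m, tail (K' l) m ≤ tail (K l) m)
    {x : ℕ} (hx : ∑' n, hitProb K n x = 1)
    (hfin : ∑' n, ((n + 1 : ℕ) : ℝ≥0∞) * hitProb K n x ≠ ∞) :
    ∑' n, hitProb K' n x = 1 ∧ ∑' n, ((n + 1 : ℕ) : ℝ≥0∞) * hitProb K' n x ≠ ∞ := by
  rw [← tsum_tail] at hfin
  simp_rw [← avoidProb_eq_tail hK hx] at hfin
  have hfin' : ∑' n, avoidProb K' n x ≠ ∞ :=
    ne_top_of_le_ne_top hfin (ENNReal.tsum_le_tsum fun n => avoidProb_le hmono hle n x)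
  have hx' : ∑' n, hitProb K' n x = 1 := by
    have h := (ENNReal.tendsto_nat_tsum fun n => hitProb K' n x).add
      (ENNReal.tendsto_atTop_zero_of_tsum_ne_top hfin')
    simp_rw [sum_hitProb_add_avoidProb hK', add_zero] at h
    exact (tendsto_nhds_unique tendsto_const_nhds h).symm
  refine ⟨hx', ?_⟩
  rw [← tsum_tail]
  simp_rw [← avoidProb_eq_tail hK' hx']
  exact hfin'

/-- The expectation of `φ` evaluated at the number of successes among the first `n` independent
trials with success probabilities `q 0, q 1, …`. -/
noncomputable def succExp (q : ℕ → ℝ) : ℕ → (ℕ → ℝ) → ℝ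
  | 0, φ => φ 0
  | n + 1, φ => q n * succExp q n (fun k => φ (k + 1)) + (1 - q n) * succExp q n φ

lemma sum_prod_mul_eq_succExp (q : ℕ → ℝ) (n : ℕ) (φ : ℕ → ℝ) :
    ∑ s : Fin n → Bool, (∏ j : Fin n, (if s j then q (j : ℕ) else 1 - q (j : ℕ)))
      * φ (Finset.univ.filter fun j => s j = true).card = succExp q n φ := by
  induction n generalizing φ with
  | zero => simp [succExp]
  | succ n ih =>
    rw [← (Fin.snocEquiv fun _ => Bool).sum_comp, Fintype.sum_prod_type]
    simp only [Finset.card_filter, Fin.sum_univ_castSucc, Fin.prod_univ_castSucc,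
      Fin.snocEquiv_apply, Fin.snoc_castSucc, Fin.snoc_last, Fin.val_castSucc, Fin.val_last,
      Fintype.sum_bool, if_true, Bool.false_eq_true, if_false, add_zero]
    rw [succExp, ← ih, ← ih, Finset.mul_sum, Finset.mul_sum]
    simp only [Finset.card_filter]
    congr 1 <;> refine Finset.sum_congr rfl fun s _ => ?_ <;> ring

lemma bbTrans_eq_succExp (q : ℕ → ℝ) (l m : ℕ) :
    bbTrans q l m = succExp q (m + l) (fun k => if k = l then 1 else 0) * q (m + l) := by
  rw [bbTrans, ← sum_prod_mul_eq_succExp, Finset.sum_filter]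
  simp

lemma succExp_sub (q : ℕ → ℝ) (n : ℕ) (φ ψ : ℕ → ℝ) :
    succExp q n (fun k => φ k - ψ k) = succExp q n φ - succExp q n ψ := by
  induction n generalizing φ ψ with
  | zero => rfl
  | succ n ih =>
    simp only [succExp]
    rw [ih, ih]
    ring

lemma succExp_mono {q : ℕ → ℝ} (hq : ∀ j, q j ∈ Set.Icc (0 : ℝ) 1) (n : ℕ) {φ ψ : ℕ → ℝ}
    (h : ∀ k, φ k ≤ ψ k) : succExp q n φ ≤ succExp q n ψ := by
  induction n generalizing φ ψ with
  | zero => exact h 0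
  | succ n ih =>
    have h1 := (hq n).1
    have h2 := sub_nonneg.2 (hq n).2
    simp only [succExp]
    gcongr
    · exact ih fun k => h _
    · exact ih h

lemma succExp_zero_fun (q : ℕ → ℝ) (n : ℕ) : succExp q n (fun _ => 0) = 0 := by
  induction n with
  | zero => rfl
  | succ n ih => simp [succExp, ih]

lemma succExp_nonneg {q : ℕ → ℝ} (hq : ∀ j, q j ∈ Set.Icc (0 : ℝ) 1) (n : ℕ) {φ : ℕ → ℝ}
    (h : ∀ k, 0 ≤ φ k) : 0 ≤ succExp q n φ :=
  (succExp_zero_fun q n).symm.trans_le (succExp_mono hq n h)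

lemma succExp_anti_prob {q q' : ℕ → ℝ} (hq : ∀ j, q j ∈ Set.Icc (0 : ℝ) 1)
    (hq' : ∀ j, q' j ∈ Set.Icc (0 : ℝ) 1) (hqq : ∀ j, q j ≤ q' j) (n : ℕ) {φ : ℕ → ℝ}
    (hφ : Antitone φ) : succExp q' n φ ≤ succExp q n φ := by
  induction n generalizing φ with
  | zero => exact le_rfl
  | succ n ih =>
    have h1 : succExp q' n (fun k => φ (k + 1)) ≤ succExp q' n φ :=
      succExp_mono hq' n fun k => hφ (Nat.le_succ k)
    have h2 := ih hφ
    have h3 := ih (φ := fun k => φ (k + 1)) fun a b hab => hφ (Nat.succ_le_succ hab)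
    have h4 := (hq n).1
    have h5 := (hq n).2
    have h6 := hqq n
    simp only [succExp]
    nlinarith [mul_nonneg (sub_nonneg.2 h6) (sub_nonneg.2 h1),
      mul_nonneg h4 (sub_nonneg.2 h3), mul_nonneg (sub_nonneg.2 h5) (sub_nonneg.2 h2)]

/-- The probability of at least `m` failures before the `(l+1)`-st success. -/
noncomputable def bbTail (q : ℕ → ℝ) (l m : ℕ) : ℝ :=
  succExp q (m + l) fun k => if k ≤ l then 1 else 0

lemma antitone_ite_le (l : ℕ) : Antitone fun k : ℕ => if k ≤ l then (1 : ℝ) else 0 := by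
  intro a b hab
  simp only
  split_ifs <;> first | omega | norm_num

lemma bbTrans_eq_bbTail_sub (q : ℕ → ℝ) (l m : ℕ) :
    bbTrans q l m = bbTail q l m - bbTail q l (m + 1) := by
  rw [bbTrans_eq_succExp, bbTail, bbTail, show m + 1 + l = m + l + 1 by ring, succExp]
  have : (fun k => if k = l then (1 : ℝ) else 0)
      = fun k => (if k ≤ l then (1 : ℝ) else 0) - (if k + 1 ≤ l then 1 else 0) := by
    funext k
    split_ifs <;> first | omega | norm_num
  rw [this, succExp_sub]
  ring

/-- The state at time `i + 1` of a path with interior states `z`, closed up by `0`. -/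
def pathExt {n : ℕ} (z : Fin n → {k : ℕ // 0 < k}) (i : ℕ) : ℕ :=
  if h : i < n then z ⟨i, h⟩ else 0

lemma hitProb_eq_tsum_paths (K : ℕ → ℕ → ℝ≥0∞) (n x : ℕ) :
    hitProb K n x = ∑' z : Fin n → {k : ℕ // 0 < k},
      K x (pathExt z 0) * ∏ i ∈ Finset.range n, K (pathExt z i) (pathExt z (i + 1)) := by
  induction n generalizing x with
  | zero => simp [hitProb, pathExt, tsum_fintype]
  | succ n ih =>
    rw [← (Fin.consEquiv fun _ : Fin (n + 1) => {k : ℕ // 0 < k}).tsum_eq,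
      ENNReal.tsum_prod', hitProb]
    have h0 : ∀ (y : {k : ℕ // 0 < k}) (z : Fin n → {k : ℕ // 0 < k}),
        pathExt (Fin.consEquiv (fun _ : Fin (n + 1) => {k : ℕ // 0 < k}) (y, z)) 0 = y := by
      intro y z
      rw [pathExt, dif_pos n.succ_pos]
      rfl
    have hs : ∀ (y : {k : ℕ // 0 < k}) (z : Fin n → {k : ℕ // 0 < k}) (i : ℕ),
        pathExt (Fin.consEquiv (fun _ : Fin (n + 1) => {k : ℕ // 0 < k}) (y, z)) (i + 1)
          = pathExt z i := by
      intro y z i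
      unfold pathExt
      by_cases h : i < n
      · rw [dif_pos h, dif_pos (Nat.succ_lt_succ h)]
        exact congrArg Subtype.val (Fin.cons_succ (α := fun _ => {k : ℕ // 0 < k}) y z ⟨i, h⟩)
      · rw [dif_neg h, dif_neg (by omega)]
    simp only [Finset.prod_range_succ', h0, hs]
    rw [← Subtype.val_injective.tsum_eq
      (f := fun y => K x y * if y = 0 then 0 else hitProb K n y)]
    · refine tsum_congr fun y => ?_
      rw [if_neg y.2.ne', ih, ENNReal.tsum_mul_left]
      congr 1
      refine tsum_congr fun z => mul_comm _ _
    · intro y hy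
      rcases Nat.eq_zero_or_pos y with rfl | h
      · simp at hy
      · exact ⟨⟨y, h⟩, rfl⟩

lemma bbTrans_nonneg {q : ℕ → ℝ} (hq : ∀ j, q j ∈ Set.Icc (0 : ℝ) 1)
    (l m : ℕ) : 0 ≤ bbTrans q l m := by
  rw [bbTrans_eq_succExp]
  refine mul_nonneg (succExp_nonneg hq _ fun k => ?_) (hq _).1
  split_ifs <;> norm_num

lemma bbTail_nonneg {q : ℕ → ℝ} (hq : ∀ j, q j ∈ Set.Icc (0 : ℝ) 1) (l m : ℕ) : 0 ≤ bbTail q l m :=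
  succExp_nonneg hq _ fun k => by split_ifs <;> norm_num

lemma bbTail_le_succ {q : ℕ → ℝ} (hq : ∀ j, q j ∈ Set.Icc (0 : ℝ) 1)
    (l m : ℕ) : bbTail q l m ≤ bbTail q (l + 1) m := by
  rw [bbTail, bbTail, ← add_assoc, succExp]
  have h : succExp q (m + l) (fun k => if k ≤ l then 1 else 0)
      ≤ succExp q (m + l) (fun k => if k ≤ l + 1 then 1 else 0) :=
    succExp_mono hq _ fun k => by split_ifs <;> first | omega | norm_num
  have h1 := (hq (m + l)).2
  simp only [Nat.add_le_add_iff_right]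
  nlinarith [mul_nonneg (sub_nonneg.2 h1) (sub_nonneg.2 h)]

lemma succExp_ite_le_bound {q : ℕ → ℝ} (hq : ∀ j, q j ∈ Set.Icc (0 : ℝ) 1)
    {c : ℝ} (hc : ∀ j, c ≤ q j) (n l : ℕ) :
    succExp q n (fun k => if k ≤ l then 1 else 0) ≤ 2 ^ l * (1 - c / 2) ^ n := by
  have hc1 : 0 ≤ 1 - c / 2 := by linarith [hc 0, (hq 0).2]
  induction n generalizing l with
  | zero => simpa [succExp] using one_le_pow₀ (one_le_two : (1 : ℝ) ≤ 2)
  | succ n ih =>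
    have h1 := (hq n).1
    have h2 := sub_nonneg.2 (hq n).2
    have hP : 0 ≤ (1 - c / 2) ^ n := pow_nonneg hc1 n
    rw [succExp]
    have key : succExp q n (fun k => if k + 1 ≤ l then 1 else 0)
        ≤ 2 ^ l / 2 * (1 - c / 2) ^ n := by
      cases l with
      | zero =>
        simp only [Nat.add_one_le_iff, Nat.not_lt_zero, if_false, succExp_zero_fun]
        positivity
      | succ l =>
        simp only [Nat.add_le_add_iff_right]
        refine (ih l).trans (le_of_eq ?_)
        ring
    calc _ ≤ q n * (2 ^ l / 2 * (1 - c / 2) ^ n) + (1 - q n) * (2 ^ l * (1 - c / 2) ^ n) := by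
          gcongr
          exact ih l
      _ = 2 ^ l * (1 - c / 2) ^ n * (1 - q n / 2) := by ring
      _ ≤ 2 ^ l * (1 - c / 2) ^ n * (1 - c / 2) := by
          gcongr
          exact hc n
      _ = _ := by ring

lemma tendsto_bbTail {q : ℕ → ℝ} (hq : ∀ j, q j ∈ Set.Icc (0 : ℝ) 1)
    {c : ℝ} (hc0 : 0 < c) (hc : ∀ j, c ≤ q j) (l : ℕ) :
    Tendsto (bbTail q l) atTop (𝓝 0) := by
  have hc1 : c ≤ 1 := (hc 0).trans (hq 0).2
  have h := ((tendsto_pow_atTop_nhds_zero_of_lt_one (r := 1 - c / 2) (by linarith)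
    (by linarith)).comp (tendsto_add_atTop_nat l)).const_mul (2 ^ l)
  rw [mul_zero] at h
  exact squeeze_zero (bbTail_nonneg hq l) (fun m => succExp_ite_le_bound hq hc (m + l) l) h

lemma tail_bbTrans {q : ℕ → ℝ} (hq : ∀ j, q j ∈ Set.Icc (0 : ℝ) 1)
    {c : ℝ} (hc0 : 0 < c) (hc : ∀ j, c ≤ q j) (l m : ℕ) :
    tail (fun k => ENNReal.ofReal (bbTrans q l k)) m = ENNReal.ofReal (bbTail q l m) := by
  have h := tail_sub_succ (t := fun m => ENNReal.ofReal (bbTail q l m))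
    (antitone_nat_of_succ_le fun m => ENNReal.ofReal_le_ofReal (by
      linarith [bbTrans_nonneg hq l m, bbTrans_eq_bbTail_sub q l m]))
    (by simpa using ENNReal.tendsto_ofReal (tendsto_bbTail hq hc0 hc l)) m
  rw [← h]
  congr 1
  funext k
  rw [bbTrans_eq_bbTail_sub, ENNReal.ofReal_sub _ (bbTail_nonneg hq _ _)]

lemma tsum_bbTrans {q : ℕ → ℝ} (hq : ∀ j, q j ∈ Set.Icc (0 : ℝ) 1)
    {c : ℝ} (hc0 : 0 < c) (hc : ∀ j, c ≤ q j) (l : ℕ) :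
    ∑' m, ENNReal.ofReal (bbTrans q l m) = 1 := by
  rw [← tail_zero, tail_bbTrans hq hc0 hc, bbTail]
  have : ∀ n L, n ≤ L → succExp q n (fun k => if k ≤ L then 1 else 0) = 1 := by
    intro n
    induction n with
    | zero => simp [succExp]
    | succ n ih =>
      intro L hL
      obtain ⟨L, rfl⟩ : ∃ L', L = L' + 1 := ⟨L - 1, by omega⟩
      simp only [succExp, Nat.add_le_add_iff_right]
      rw [ih L (by omega), ih (L + 1) (by omega)]
      ring
  simp [this]

lemma returnProb_succ {q : ℕ → ℝ} (hq : ∀ j, q j ∈ Set.Icc (0 : ℝ) 1) (n : ℕ) :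
    returnProb q (n + 1) = (hitProb (fun l m => ENNReal.ofReal (bbTrans q l m)) n 0).toReal := by
  rw [hitProb_eq_tsum_paths, returnProb, dif_neg n.succ_ne_zero, ENNReal.tsum_toReal_eq]
  · change ∑' z : Fin n → {k : ℕ // 0 < k}, _ = _
    refine tsum_congr fun z => ?_
    rw [Finset.prod_range_succ', ENNReal.toReal_mul, ENNReal.toReal_prod, mul_comm]
    congr 1
    · rw [ENNReal.toReal_ofReal (bbTrans_nonneg hq _ _)]
      congr 1
      unfold pathExt
      by_cases h : 0 < n
      · rw [dif_pos (by omega), dif_pos h]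
      · rw [dif_neg (by omega), dif_neg h]
    · refine Finset.prod_congr rfl fun i hi => ?_
      have hi : i < n := Finset.mem_range.1 hi
      rw [ENNReal.toReal_ofReal (bbTrans_nonneg hq _ _)]
      unfold pathExt
      rw [dif_pos hi, dif_pos (by omega)]
      congr 1
      by_cases h : i + 1 < n
      · rw [dif_pos (by omega), dif_pos h]
      · rw [dif_neg (by omega), dif_neg h]
  · intro z
    exact ENNReal.mul_ne_top ENNReal.ofReal_ne_top
      (ENNReal.prod_ne_top fun _ _ => ENNReal.ofReal_ne_top)

/-- Positive recurrence of `0` in terms of first hitting probabilities. -/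
lemma returnProb_posRecurrent_iff {q : ℕ → ℝ} (hq : ∀ j, q j ∈ Set.Icc (0 : ℝ) 1)
    {c : ℝ} (hc0 : 0 < c) (hc : ∀ j, c ≤ q j) :
    ((∑' n : ℕ, returnProb q n) = 1 ∧ Summable fun n : ℕ => (n : ℝ) * returnProb q n) ↔
      (∑' n, hitProb (fun l m => ENNReal.ofReal (bbTrans q l m)) n 0 = 1 ∧
        ∑' n, ((n + 1 : ℕ) : ℝ≥0∞) * hitProb (fun l m => ENNReal.ofReal (bbTrans q l m)) n 0
          ≠ ∞) := by
  set w : ℕ → ℝ≥0∞ := fun n => hitProb (fun l m => ENNReal.ofReal (bbTrans q l m)) n 0 with hw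
  have hw1 : ∀ n, w n ≠ ∞ := by
    intro n
    have h := sum_hitProb_add_avoidProb (tsum_bbTrans hq hc0 hc) (n + 1) 0
    rw [Finset.sum_range_succ] at h
    exact ne_top_of_le_ne_top ENNReal.one_ne_top
      (h ▸ (le_add_self.trans le_self_add))
  have hr : ∀ n, returnProb q (n + 1) = (w n).toReal := returnProb_succ hq
  have hr0 : returnProb q 0 = 0 := by simp [returnProb]
  have hsumm : Summable (returnProb q) ↔ Summable fun n => (w n).toReal := by
    rw [← summable_nat_add_iff 1]
    simp_rw [hr]
  have htsum : ∑' n, returnProb q n = ∑' n, (w n).toReal := by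
    by_cases h : Summable (returnProb q)
    · rw [h.tsum_eq_zero_add, hr0, zero_add]
      simp_rw [hr]
    · rw [tsum_eq_zero_of_not_summable h, tsum_eq_zero_of_not_summable (mt hsumm.2 h)]
  have hfst : ∑' n, (w n).toReal = 1 ↔ ∑' n, w n = 1 := by
    rw [← ENNReal.tsum_toReal_eq hw1, ENNReal.toReal_eq_one_iff]
  have hsnd : (Summable fun n : ℕ => (n : ℝ) * returnProb q n)
      ↔ ∑' n, ((n + 1 : ℕ) : ℝ≥0∞) * w n ≠ ∞ := by
    rw [← summable_nat_add_iff 1]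
    have : ∀ n, ((n + 1 : ℕ) : ℝ) * returnProb q (n + 1)
        = (((n + 1 : ℕ) : ℝ≥0∞) * w n).toReal := by
      intro n
      rw [hr, ENNReal.toReal_mul, ENNReal.toReal_natCast]
    simp_rw [this]
    constructor
    · intro h
      have h2 := h.tsum_ofReal_ne_top
      simp_rw [ENNReal.ofReal_toReal (ENNReal.mul_ne_top (ENNReal.natCast_ne_top _) (hw1 _))]
        at h2
      exact h2
    · exact ENNReal.summable_toReal
  rw [htsum, hfst, hsnd]

lemma IsStationaryDist.ofReal {q : ℕ → ℝ} (hq : ∀ j, q j ∈ Set.Icc (0 : ℝ) 1)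
    {c : ℝ} (hc0 : 0 < c) (hc : ∀ j, c ≤ q j) {π : ℕ → ℝ}
    (hπ : IsStationaryDist q π) :
    ∑' m, ENNReal.ofReal (π m) = 1 ∧ ∀ m, ENNReal.ofReal (π m)
      = ∑' l, ENNReal.ofReal (π l) * ENNReal.ofReal (bbTrans q l m) := by
  obtain ⟨h0, h1, h2⟩ := hπ
  have hs : Summable π := by
    by_contra h
    simp [tsum_eq_zero_of_not_summable h] at h1
  refine ⟨by rw [← ENNReal.ofReal_tsum_of_nonneg h0 hs, h1, ENNReal.ofReal_one], fun m => ?_⟩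
  have hle : ∀ l, bbTrans q l m ≤ 1 := by
    intro l
    have := (ENNReal.le_tsum m).trans_eq (tsum_bbTrans hq hc0 hc l)
    exact ENNReal.ofReal_le_one.1 this
  rw [h2 m, ENNReal.ofReal_tsum_of_nonneg]
  · exact tsum_congr fun l => ENNReal.ofReal_mul (h0 l)
  · exact fun l => mul_nonneg (h0 l) (bbTrans_nonneg hq l m)
  · exact hs.of_nonneg_of_le (fun l => mul_nonneg (h0 l) (bbTrans_nonneg hq l m))
      fun l => mul_le_of_le_one_right (h0 l) (hle l)

lemma isStationaryDist_toReal {q : ℕ → ℝ} (hq : ∀ j, q j ∈ Set.Icc (0 : ℝ) 1)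
    {μ : ℕ → ℝ≥0∞} (h1 : ∑' m, μ m = 1)
    (h2 : ∀ m, μ m = ∑' l, μ l * ENNReal.ofReal (bbTrans q l m)) :
    IsStationaryDist q fun m => (μ m).toReal := by
  have hfin : ∀ m, μ m ≠ ∞ := fun m =>
    ne_top_of_le_ne_top ENNReal.one_ne_top (h1 ▸ ENNReal.le_tsum m)
  refine ⟨fun k => ENNReal.toReal_nonneg, ?_, fun m => ?_⟩
  · rw [← ENNReal.tsum_toReal_eq hfin, h1, ENNReal.toReal_one]
  · simp only
    rw [h2 m, ENNReal.tsum_toReal_eq fun l => ENNReal.mul_ne_top (hfin l) ENNReal.ofReal_ne_top]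
    refine tsum_congr fun l => ?_
    rw [ENNReal.toReal_mul, ENNReal.toReal_ofReal (bbTrans_nonneg hq l m)]

lemma bbTrans_comparison {q q' : ℕ → ℝ} (hq : ∀ j, q j ∈ Set.Icc (0 : ℝ) 1)
    (hq' : ∀ j, q' j ∈ Set.Icc (0 : ℝ) 1) (hqq : ∀ j, q j ≤ q' j)
    {c : ℝ} (hc0 : 0 < c) (hc : ∀ j, c ≤ q j)
    (hrec : (∑' n : ℕ, returnProb q n) = 1 ∧ Summable fun n : ℕ => (n : ℝ) * returnProb q n)
    {π : ℕ → ℝ} (hπ : IsStationaryDist q π) :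
    ((∑' n : ℕ, returnProb q' n) = 1 ∧ Summable fun n : ℕ => (n : ℝ) * returnProb q' n)
    ∧ ∃ π' : ℕ → ℝ, IsStationaryDist q' π'
        ∧ (∑' k : ℕ, (k : ℝ≥0∞) * ENNReal.ofReal (π' k))
            ≤ ∑' k : ℕ, (k : ℝ≥0∞) * ENNReal.ofReal (π k) := by
  have hc' : ∀ j, c ≤ q' j := fun j => (hc j).trans (hqq j)
  have hmono : ∀ m, Monotone fun l => tail (fun k => ENNReal.ofReal (bbTrans q' l k)) m := by
    intro m
    simp_rw [tail_bbTrans hq' hc0 hc']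
    exact monotone_nat_of_le_succ fun l => ENNReal.ofReal_le_ofReal (bbTail_le_succ hq' l m)
  have hle : ∀ l m, tail (fun k => ENNReal.ofReal (bbTrans q' l k)) m
      ≤ tail (fun k => ENNReal.ofReal (bbTrans q l k)) m := by
    intro l m
    rw [tail_bbTrans hq' hc0 hc', tail_bbTrans hq hc0 hc]
    exact ENNReal.ofReal_le_ofReal (succExp_anti_prob hq hq' hqq _ (antitone_ite_le l))
  have hsum := tsum_bbTrans hq hc0 hc
  have hsum' := tsum_bbTrans hq' hc0 hc'
  rw [returnProb_posRecurrent_iff hq hc0 hc] at hrec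
  rw [returnProb_posRecurrent_iff hq' hc0 hc']
  refine ⟨hitProb_comparison hsum hsum' hmono hle hrec.1 hrec.2, ?_⟩
  obtain ⟨hπ1, hπ2⟩ := hπ.ofReal hq hc0 hc
  obtain ⟨μ, hμ1, hμ2, hμ3⟩ := exists_stationary_tail_le hsum' hmono hle hπ1 hπ2
  refine ⟨_, isStationaryDist_toReal hq' hμ1 hμ2, ?_⟩
  have hfin : ∀ m, μ m ≠ ∞ := fun m =>
    ne_top_of_le_ne_top ENNReal.one_ne_top (hμ1 ▸ ENNReal.le_tsum m)
  simp_rw [ENNReal.ofReal_toReal (hfin _), mul_comm (Nat.cast _ : ℝ≥0∞)]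
  exact tsum_mul_le_of_tail_le hμ3 Nat.mono_cast

/-- **Coupling comparison of backwards branching-like processes.**
Let `p₀ ∈ (1/2,1)`, `p ∈ (0,1)^M`, `N > M`, and let `p' = (p 1,…,p M, p₀,…,p₀) ∈ (0,1)^N`.
Let `Z^∞` be the backwards branching-like process associated to `(M, p, p₀)` and `Z^N`
the one associated to the standard excited random walk with cookie vector `p'` (i.e. to
`(N, p', 1/2)`).  If `Z^N` is positive recurrent with stationary distribution `π_N`,
then `Z^∞` is positive recurrent, has a stationary distribution `π_∞`, and
`∑ k, k π_∞ k ≤ ∑ k, k π_N k` (means computed in `ℝ≥0∞`). -/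
theorem bb_coupling_comparison
    (M N : ℕ) (hM : 1 ≤ M) (hMN : M < N)
    (p : Fin M → ℝ) (hp : ∀ i, p i ∈ Set.Ioo (0 : ℝ) 1)
    (p₀ : ℝ) (hp₀ : p₀ ∈ Set.Ioo (1 / 2 : ℝ) 1)
    (p' : Fin N → ℝ)
    (hp' : ∀ i : Fin N, p' i = if h : (i : ℕ) < M then p ⟨i, h⟩ else p₀)
    (πN : ℕ → ℝ)
    (hrecN : (∑' n : ℕ, returnProb (cookieSeq N p' (1 / 2)) n) = 1
      ∧ Summable fun n : ℕ => (n : ℝ) * returnProb (cookieSeq N p' (1 / 2)) n)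
    (hπN : IsStationaryDist (cookieSeq N p' (1 / 2)) πN) :
    ((∑' n : ℕ, returnProb (cookieSeq M p p₀) n) = 1
        ∧ Summable fun n : ℕ => (n : ℝ) * returnProb (cookieSeq M p p₀) n)
    ∧ ∃ πinf : ℕ → ℝ, IsStationaryDist (cookieSeq M p p₀) πinf
        ∧ (∑' k : ℕ, (k : ℝ≥0∞) * ENNReal.ofReal (πinf k))
            ≤ ∑' k : ℕ, (k : ℝ≥0∞) * ENNReal.ofReal (πN k) := by
  have hp'mem : ∀ i, p' i ∈ Set.Ioo (0 : ℝ) 1 := by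
    intro i
    rw [hp']
    split_ifs
    · exact hp _
    · exact ⟨by linarith [hp₀.1], hp₀.2⟩
  have hq : ∀ j, cookieSeq N p' (1 / 2) j ∈ Set.Ioo (0 : ℝ) 1 := by
    intro j
    unfold cookieSeq
    split_ifs
    · exact hp'mem _
    · norm_num
  have hq' : ∀ j, cookieSeq M p p₀ j ∈ Set.Ioo (0 : ℝ) 1 := by
    intro j
    unfold cookieSeq
    split_ifs
    · exact hp _
    · exact ⟨by linarith [hp₀.1], hp₀.2⟩
  have hqq : ∀ j, cookieSeq N p' (1 / 2) j ≤ cookieSeq M p p₀ j := by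
    intro j
    unfold cookieSeq
    by_cases h : j < N
    · rw [dif_pos h, hp']
    · rw [dif_neg h, dif_neg (by omega)]
      exact hp₀.1.le
  obtain ⟨c, hc0, hc⟩ : ∃ c : ℝ, 0 < c ∧ ∀ j, c ≤ cookieSeq N p' (1 / 2) j := by
    have hne : (Finset.range (N + 1)).Nonempty := ⟨0, by simp⟩
    obtain ⟨i, -, hi⟩ := Finset.exists_min_image _ (cookieSeq N p' (1 / 2)) hne
    refine ⟨_, (hq i).1, fun j => ?_⟩
    by_cases h : j < N
    · exact hi j (Finset.mem_range.2 (by omega))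
    · have h1 := hi N (Finset.mem_range.2 (by omega))
      simpa [cookieSeq, h] using h1
  exact bbTrans_comparison (fun j => Set.Ioo_subset_Icc_self (hq j))
    (fun j => Set.Ioo_subset_Icc_self (hq' j)) hqq hc0 hc hrecN hπN
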